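/- For every integer n ≥ 2 there exists a constant c > 0, depending only on n, with the following property: for every odd positive integer m, every real μ ∈ (m, m+1], and every Legendre function p for the pair (n, μ), one has p(0) ≠ 0 and −p'(0)/p(0) ≥ c · m · (m + 1 − μ). -/

import Mathlib

open Real Set Filter

/-- `p` is a Legendre function for the pair `(n, μ)`, with derivative `p'` (denoted `p₁`):
`p` is `C¹` on `[0, π/2]`, `C²` on `[0, π/2)`, solves
`p'' - (n-2)·tan(φ)·p' + μ(μ+n-2)·p = 0` on `[0, π/2)`, and `p(π/2) = 1`, `p'(π/2) = 0`. -/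
def IsLegendre (n : ℕ) (μ : ℝ) (p p₁ : ℝ → ℝ) : Prop :=
  (∀ φ ∈ Set.Icc (0 : ℝ) (π / 2), HasDerivWithinAt p (p₁ φ) (Set.Icc 0 (π / 2)) φ) ∧
  ContinuousOn p₁ (Set.Icc 0 (π / 2)) ∧
  (∃ p₂ : ℝ → ℝ,
    (∀ φ ∈ Set.Ico (0 : ℝ) (π / 2), HasDerivWithinAt p₁ (p₂ φ) (Set.Ico 0 (π / 2)) φ) ∧
    ContinuousOn p₂ (Set.Ico 0 (π / 2)) ∧
    ∀ φ ∈ Set.Ico (0 : ℝ) (π / 2),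
      p₂ φ - (n - 2 : ℝ) * Real.tan φ * p₁ φ + μ * (μ + n - 2) * p φ = 0) ∧
  p (π / 2) = 1 ∧ p₁ (π / 2) = 0

/-- Weak form of the Legendre problem, with `N = n - 2`. -/
def WeakLeg (N : ℕ) (μ : ℝ) (p p₁ : ℝ → ℝ) : Prop :=
  ContinuousOn p (Set.Icc 0 (π / 2)) ∧ ContinuousOn p₁ (Set.Icc 0 (π / 2)) ∧
  (∀ φ ∈ Set.Ioo (0 : ℝ) (π / 2), HasDerivAt p (p₁ φ) φ) ∧
  (∀ φ ∈ Set.Ioo (0 : ℝ) (π / 2),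
    HasDerivAt p₁ ((N : ℝ) * Real.tan φ * p₁ φ - μ * (μ + N) * p φ) φ) ∧
  p (π / 2) = 1 ∧ p₁ (π / 2) = 0

theorem IsLegendre.weak {N : ℕ} {μ : ℝ} {p p₁ : ℝ → ℝ} (h : IsLegendre (N + 2) μ p p₁) :
    WeakLeg N μ p p₁ := by
  obtain ⟨h1, h2, ⟨p₂, h3, -, h4⟩, h5, h6⟩ := h
  refine ⟨fun x hx => (h1 x hx).continuousWithinAt, h2, fun x hx => ?_, fun x hx => ?_, h5, h6⟩
  · exact (h1 x (Ioo_subset_Icc_self hx)).hasDerivAt (Icc_mem_nhds hx.1 hx.2)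
  · have := (h3 x (Ioo_subset_Ico_self hx)).hasDerivAt (Ico_mem_nhds hx.1 hx.2)
    have e := h4 x (Ioo_subset_Ico_self hx)
    refine this.congr_deriv ?_
    push_cast at e
    linear_combination e

theorem cos_pos' {φ : ℝ} (h : φ ∈ Set.Ioo (0 : ℝ) (π / 2)) : 0 < Real.cos φ :=
  Real.cos_pos_of_mem_Ioo ⟨by linarith [h.1, Real.pi_pos], h.2⟩

theorem sin_pos' {φ : ℝ} (h : φ ∈ Set.Ioo (0 : ℝ) (π / 2)) : 0 < Real.sin φ :=
  Real.sin_pos_of_pos_of_lt_pi h.1 (by linarith [h.2, Real.pi_pos])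

theorem WeakLeg.lower {N : ℕ} {μ : ℝ} {p p₁ : ℝ → ℝ} (h : WeakLeg N μ p p₁) (hμ : 0 < μ) :
    WeakLeg N (μ - 1) (fun φ => Real.sin φ * p φ + Real.cos φ * p₁ φ / μ)
      (fun φ => (μ + N - 1) * (-(Real.cos φ * p φ) + Real.sin φ * p₁ φ / μ)) := by
  obtain ⟨h1, h2, h3, h4, h5, h6⟩ := h
  refine ⟨by fun_prop, by fun_prop, fun x hx => ?_, fun x hx => ?_, by simp [h5, h6],
    by simp [h6]⟩
  · have hc := (cos_pos' hx).ne'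
    have := ((Real.hasDerivAt_sin x).mul (h3 x hx)).add
      (((Real.hasDerivAt_cos x).mul (h4 x hx)).div_const μ)
    refine this.congr_deriv ?_
    rw [Real.tan_eq_sin_div_cos]
    field_simp
    ring
  · have hc := (cos_pos' hx).ne'
    have := ((((Real.hasDerivAt_cos x).mul (h3 x hx)).neg).add
      (((Real.hasDerivAt_sin x).mul (h4 x hx)).div_const μ)).const_mul (μ + N - 1)
    refine this.congr_deriv ?_
    rw [Real.tan_eq_sin_div_cos]
    field_simp
    ring

theorem hasDerivAt_cosPow (N : ℕ) {φ : ℝ} (h : φ ∈ Set.Ioo (0 : ℝ) (π / 2)) :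
    HasDerivAt (fun x => Real.cos x ^ N) (-(N * Real.tan φ * Real.cos φ ^ N)) φ := by
  have hc := (cos_pos' h).ne'
  refine ((Real.hasDerivAt_cos φ).pow N).congr_deriv ?_
  rw [Real.tan_eq_sin_div_cos]
  cases N with
  | zero => simp
  | succ k => simp only [Nat.add_sub_cancel, pow_succ]; field_simp

theorem WeakLeg.derivF {N : ℕ} {μ : ℝ} {p p₁ : ℝ → ℝ} (h : WeakLeg N μ p p₁) {φ : ℝ}
    (hφ : φ ∈ Set.Ioo (0 : ℝ) (π / 2)) :
    HasDerivAt (fun x => Real.cos x ^ N * p₁ x) (-(μ * (μ + N) * Real.cos φ ^ N * p φ)) φ := by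
  refine ((hasDerivAt_cosPow N hφ).mul (h.2.2.2.1 φ hφ)).congr_deriv ?_
  ring

theorem WeakLeg.derivW {N : ℕ} {μ : ℝ} {p p₁ : ℝ → ℝ} (h : WeakLeg N μ p p₁) {φ : ℝ}
    (hφ : φ ∈ Set.Ioo (0 : ℝ) (π / 2)) :
    HasDerivAt (fun x => Real.cos x ^ N * (p₁ x * Real.sin x - p x * Real.cos x))
      ((1 - μ) * (1 + μ + N) * Real.cos φ ^ N * p φ * Real.sin φ) φ := by
  have hc := (cos_pos' hφ).ne'
  refine ((hasDerivAt_cosPow N hφ).mul (((h.2.2.2.1 φ hφ).mul (Real.hasDerivAt_sin φ)).sub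
    ((h.2.2.1 φ hφ).mul (Real.hasDerivAt_cos φ)))).congr_deriv ?_
  simp only [Pi.sub_apply, Pi.mul_apply]
  rw [Real.tan_eq_sin_div_cos]
  field_simp
  ring

/-- Positivity for `σ ∈ (0, 1]`. -/
theorem WeakLeg.pos {N : ℕ} {σ : ℝ} {q q₁ : ℝ → ℝ} (h : WeakLeg N σ q q₁) (h0 : 0 < σ)
    (h1 : σ ≤ 1) : ∀ φ ∈ Set.Ioc (0 : ℝ) (π / 2), 0 < q φ := by
  by_contra! hcon
  obtain ⟨b, hb, hqb⟩ := hcon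
  have hpi := Real.pi_pos
  obtain ⟨c1, c2, d1, d2, e1, e2⟩ := id h
  -- the zero set
  have hcl : IsCompact {x ∈ Set.Icc b (π / 2) | q x ≤ 0} := by
    have hc : ContinuousOn q (Set.Icc b (π / 2)) :=
      c1.mono (Set.Icc_subset_Icc hb.1.le le_rfl)
    have := hc.preimage_isClosed_of_isClosed isClosed_Icc (isClosed_Iic (a := (0 : ℝ)))
    exact isCompact_Icc.of_isClosed_subset this (fun x hx => hx.1)
  obtain ⟨a, ⟨ha, hqa⟩, hmax⟩ := hcl.exists_isGreatest ⟨b, ⟨le_rfl, hb.2⟩, hqb⟩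
  have ha0 : 0 < a := lt_of_lt_of_le hb.1 ha.1
  have ha2 : a < π / 2 := by
    rcases ha.2.lt_or_eq with h | h
    · exact h
    · rw [h, e1] at hqa; linarith
  have hpos : ∀ x ∈ Set.Ioo a (π / 2), 0 < q x := by
    intro x hx
    by_contra! hh
    have := hmax ⟨⟨ha.1.trans hx.1.le, hx.2.le⟩, hh⟩
    linarith [hx.1]
  have hsub : Set.Icc a (π / 2) ⊆ Set.Icc 0 (π / 2) := Set.Icc_subset_Icc ha0.le le_rfl
  have hsubo : ∀ x ∈ Set.Ioo a (π / 2), x ∈ Set.Ioo 0 (π / 2) := fun x hx =>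
    ⟨ha0.trans hx.1, hx.2⟩
  have c1' := c1.mono hsub
  have c2' := c2.mono hsub
  have hF : StrictAntiOn (fun x => Real.cos x ^ N * q₁ x) (Set.Icc a (π / 2)) := by
    apply strictAntiOn_of_deriv_neg (convex_Icc _ _) (by fun_prop)
    intro x hx
    rw [interior_Icc] at hx
    rw [(h.derivF (hsubo x hx)).deriv]
    have := pow_pos (cos_pos' (hsubo x hx)) N
    have := hpos x hx
    have : 0 < σ * (σ + N) * Real.cos x ^ N * q x := by positivity
    linarith
  have hW : MonotoneOn (fun x => Real.cos x ^ N * (q₁ x * Real.sin x - q x * Real.cos x))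
      (Set.Icc a (π / 2)) := by
    apply monotoneOn_of_deriv_nonneg (convex_Icc _ _) (by fun_prop)
    · intro x hx
      rw [interior_Icc] at hx
      exact (h.derivW (hsubo x hx)).differentiableAt.differentiableWithinAt
    intro x hx
    rw [interior_Icc] at hx
    rw [(h.derivW (hsubo x hx)).deriv]
    have := pow_pos (cos_pos' (hsubo x hx)) N
    have := sin_pos' (hsubo x hx)
    have := hpos x hx
    have : 0 ≤ 1 - σ := by linarith
    positivity
  have i1 := hF ⟨le_rfl, ha2.le⟩ ⟨ha2.le, le_rfl⟩ ha2
  have i2 := hW ⟨le_rfl, ha2.le⟩ ⟨ha2.le, le_rfl⟩ ha2.le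
  simp only [e2, Real.cos_pi_div_two] at i1 i2
  have i3 : 0 < Real.cos a ^ N * q₁ a := by simpa using i1
  have hs := sin_pos' ⟨ha0, ha2⟩
  have hc := cos_pos' ⟨ha0, ha2⟩
  have i4 : Real.cos a ^ N * (q₁ a * Real.sin a - q a * Real.cos a) ≤ 0 := by simpa using i2
  have i5 : 0 < Real.cos a ^ N * q₁ a * Real.sin a := by positivity
  have i6 : 0 ≤ Real.cos a ^ N * (-q a) * Real.cos a := by
    have : 0 ≤ -q a := by linarith
    positivity
  nlinarith

theorem WeakLeg.base {N : ℕ} {σ : ℝ} {q q₁ : ℝ → ℝ} (h : WeakLeg N σ q q₁) (h0 : 0 < σ)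
    (h1 : σ ≤ 1) : 0 < q₁ 0 ∧ q₁ 0 ≤ σ * (σ + N) * (π / 2) ∧
      2 * ((1 - σ) * (1 + σ + N)) ≤ q 0 * ((N + 1) * (N + 3)) := by
  have hpi := Real.pi_pos
  have hp := h.pos h0 h1
  have hp' : ∀ x ∈ Set.Ioo 0 (π / 2), 0 < q x := fun x hx => hp x ⟨hx.1, hx.2.le⟩
  obtain ⟨c1, c2, d1, d2, e1, e2⟩ := id h
  have m0 : (0 : ℝ) ∈ Set.Icc 0 (π / 2) := ⟨le_rfl, by linarith⟩
  have m1 : π / 2 ∈ Set.Icc 0 (π / 2) := ⟨by linarith, le_rfl⟩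
  have hF : StrictAntiOn (fun x => Real.cos x ^ N * q₁ x) (Set.Icc 0 (π / 2)) := by
    apply strictAntiOn_of_deriv_neg (convex_Icc _ _) (by fun_prop)
    intro x hx
    rw [interior_Icc] at hx
    rw [(h.derivF hx).deriv]
    have := pow_pos (cos_pos' hx) N
    have := hp' x hx
    have : 0 < σ * (σ + N) * Real.cos x ^ N * q x := by positivity
    linarith
  have hq₁ : ∀ x ∈ Set.Ioo 0 (π / 2), 0 < q₁ x := by
    intro x hx
    have := hF (Ioo_subset_Icc_self hx) m1 hx.2
    simp only [e2, mul_zero] at this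
    exact (pos_iff_pos_of_mul_pos this).1 (pow_pos (cos_pos' hx) N)
  have hmono : MonotoneOn q (Set.Icc 0 (π / 2)) := by
    apply monotoneOn_of_deriv_nonneg (convex_Icc _ _) c1
    · intro x hx
      rw [interior_Icc] at hx
      exact (d1 x hx).differentiableAt.differentiableWithinAt
    · intro x hx
      rw [interior_Icc] at hx
      rw [(d1 x hx).deriv]
      exact (hq₁ x hx).le
  have hle : ∀ x ∈ Set.Ioo 0 (π / 2), q x ≤ 1 := by
    intro x hx
    rw [← e1]
    exact hmono (Ioo_subset_Icc_self hx) m1 hx.2.le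
  have hW : MonotoneOn (fun x => Real.cos x ^ N * (q₁ x * Real.sin x - q x * Real.cos x))
      (Set.Icc 0 (π / 2)) := by
    apply monotoneOn_of_deriv_nonneg (convex_Icc _ _) (by fun_prop)
    · intro x hx
      rw [interior_Icc] at hx
      exact (h.derivW hx).differentiableAt.differentiableWithinAt
    intro x hx
    rw [interior_Icc] at hx
    rw [(h.derivW hx).deriv]
    have := pow_pos (cos_pos' hx) N
    have := sin_pos' hx
    have := hp' x hx
    have : 0 ≤ 1 - σ := by linarith
    positivity
  have hWle : ∀ x ∈ Set.Ioo 0 (π / 2), q₁ x * Real.sin x - q x * Real.cos x ≤ 0 := by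
    intro x hx
    have := hW (Ioo_subset_Icc_self hx) m1 hx.2.le
    simp only [e2, Real.cos_pi_div_two, zero_mul, mul_zero, sub_zero] at this
    by_contra! hh
    have := mul_pos (pow_pos (cos_pos' hx) N) hh
    linarith
  have hsin : ∀ x ∈ Set.Ioo 0 (π / 2), Real.sin x ≤ q x := by
    intro x hx
    have hanti : AntitoneOn (fun y => q y / Real.sin y) (Set.Icc x (π / 2)) := by
      have hd : ∀ y ∈ Set.Ioo x (π / 2), HasDerivAt (fun y => q y / Real.sin y)
          ((q₁ y * Real.sin y - q y * Real.cos y) / Real.sin y ^ 2) y := fun y hy =>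
        (d1 y ⟨hx.1.trans hy.1, hy.2⟩).div (Real.hasDerivAt_sin y)
          (sin_pos' ⟨hx.1.trans hy.1, hy.2⟩).ne'
      apply antitoneOn_of_deriv_nonpos (convex_Icc _ _)
      · apply (c1.mono (Set.Icc_subset_Icc hx.1.le le_rfl)).div (by fun_prop)
        intro y hy
        exact (Real.sin_pos_of_pos_of_lt_pi (hx.1.trans_le hy.1) (by linarith [hy.2])).ne'
      · intro y hy
        rw [interior_Icc] at hy
        exact (hd y hy).differentiableAt.differentiableWithinAt
      · intro y hy
        rw [interior_Icc] at hy
        rw [(hd y hy).deriv]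
        exact div_nonpos_of_nonpos_of_nonneg (hWle y ⟨hx.1.trans hy.1, hy.2⟩) (sq_nonneg _)
    have := hanti ⟨le_rfl, hx.2.le⟩ ⟨hx.2.le, le_rfl⟩ hx.2.le
    simp only [e1, Real.sin_pi_div_two, div_one] at this
    rwa [le_div_iff₀ (sin_pos' hx), one_mul] at this
  refine ⟨?_, ?_, ?_⟩
  · have := hF m0 m1 (by linarith)
    simpa [e2] using this
  · have hd : ∀ x ∈ Set.Ioo 0 (π / 2), HasDerivAt
        (fun x => Real.cos x ^ N * q₁ x + σ * (σ + N) * x)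
        (-(σ * (σ + N) * Real.cos x ^ N * q x) + σ * (σ + N) * 1) x := fun x hx =>
      (h.derivF hx).add ((hasDerivAt_id x).const_mul _)
    have hm : MonotoneOn (fun x => Real.cos x ^ N * q₁ x + σ * (σ + N) * x)
        (Set.Icc 0 (π / 2)) := by
      apply monotoneOn_of_deriv_nonneg (convex_Icc _ _) (by fun_prop)
      · intro x hx
        rw [interior_Icc] at hx
        exact (hd x hx).differentiableAt.differentiableWithinAt
      intro x hx
      rw [interior_Icc] at hx
      rw [(hd x hx).deriv]
      have a1 : Real.cos x ^ N ≤ 1 := pow_le_one₀ (cos_pos' hx).le (Real.cos_le_one x)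
      have a2 : Real.cos x ^ N * q x ≤ 1 :=
        mul_le_one₀ a1 (hp' x hx).le (hle x hx)
      have a3 : 0 < σ * (σ + N) := by positivity
      nlinarith
    have := hm m0 m1 (by linarith)
    simpa [e2] using this
  · set κ := (1 - σ) * (1 + σ + N) with hκ
    have hκ0 : 0 ≤ κ := mul_nonneg (by linarith) (by positivity)
    have hN1 : (0 : ℝ) < N + 1 := by positivity
    have hN3 : (0 : ℝ) < N + 3 := by positivity
    have hG : ∀ x, HasDerivAt (fun x => κ * (Real.cos x ^ (N + 1) / (N + 1)
        - Real.cos x ^ (N + 3) / (N + 3))) (-(κ * Real.cos x ^ N * Real.sin x ^ 3)) x := by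
      intro x
      refine (((((Real.hasDerivAt_cos x).pow (N + 1)).div_const _).sub
        (((Real.hasDerivAt_cos x).pow (N + 3)).div_const _)).const_mul κ).congr_deriv ?_
      have hs : Real.sin x ^ 3 = Real.sin x * (1 - Real.cos x ^ 2) := by
        rw [← Real.sin_sq]; ring
      rw [hs]
      have t1 : N + 3 - 1 = N + 2 := rfl
      simp only [t1, Nat.add_sub_cancel]
      push_cast
      field_simp
      ring
    have hm : MonotoneOn (fun x => Real.cos x ^ N * (q₁ x * Real.sin x - q x * Real.cos x)
        + κ * (Real.cos x ^ (N + 1) / (N + 1) - Real.cos x ^ (N + 3) / (N + 3)))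
        (Set.Icc 0 (π / 2)) := by
      apply monotoneOn_of_deriv_nonneg (convex_Icc _ _) (by fun_prop)
      · intro x hx
        rw [interior_Icc] at hx
        exact ((h.derivW hx).add (hG x)).differentiableAt.differentiableWithinAt
      intro x hx
      rw [interior_Icc] at hx
      have := ((h.derivW hx).add (hG x)).deriv
      simp only [Pi.add_def] at this
      rw [this, ← hκ]
      have a1 := sin_pos' hx
      have a2 : Real.sin x ^ 2 ≤ q x := by
        have := hsin x hx
        nlinarith [Real.sin_le_one x]
      have a3 : 0 ≤ κ * Real.cos x ^ N * Real.sin x :=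
        mul_nonneg (mul_nonneg hκ0 (pow_pos (cos_pos' hx) N).le) a1.le
      nlinarith
    have := hm m0 m1 (by linarith)
    simp [e2] at this
    have h2 : κ * (((N : ℝ) + 1)⁻¹ - ((N : ℝ) + 3)⁻¹) ≤ q 0 := by linarith
    have h3 : κ * (((N : ℝ) + 1)⁻¹ - ((N : ℝ) + 3)⁻¹) * ((N + 1) * (N + 3)) = 2 * κ := by
      field_simp
      ring
    rw [← h3]
    exact mul_le_mul_of_nonneg_right h2 (by positivity)

theorem weak_bound (N : ℕ) (k : ℕ) : ∀ μ : ℝ, 2 * (k : ℝ) + 1 < μ → μ ≤ 2 * k + 2 →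
    ∀ p p₁ : ℝ → ℝ, WeakLeg N μ p p₁ → p 0 ≠ 0 ∧
      1 / ((N : ℝ) + 3) ^ 2 * (μ + (N + 1) / 2) * (2 * k + 2 - μ) ≤ -(p₁ 0) / p 0 := by
  have hN0 : (0 : ℝ) ≤ N := Nat.cast_nonneg N
  induction k with
  | zero =>
    intro μ h1 h2 p p₁ h
    norm_num at h1 h2
    have hl := h.lower (by linarith)
    obtain ⟨b1, b2, b3⟩ := hl.base (by linarith) (by linarith)
    simp at b1 b2 b3
    have hM : 0 < μ + N - 1 := by linarith
    have hp : p 0 < 0 := by nlinarith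
    refine ⟨hp.ne, ?_⟩
    have hpi := Real.pi_lt_four
    have hpi0 := Real.pi_pos
    have e : -(p₁ 0) / p 0 = p₁ 0 / (-p 0) := by rw [neg_div, div_neg]
    rw [e, le_div_iff₀ (by linarith)]
    have b2' : -p 0 ≤ (μ - 1) * 2 := by
      have : (μ + N - 1) * (-p 0) ≤ (μ + N - 1) * ((μ - 1) * (π / 2)) := by linarith
      have := le_of_mul_le_mul_left this hM
      nlinarith
    have b3' : 2 * (2 - μ) * μ ≤ p₁ 0 * (N + 3) := by
      have h5 : p₁ 0 / μ * μ = p₁ 0 := div_mul_cancel₀ _ (by linarith)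
      have h6 : 2 * (2 - μ) * (N + 1) ≤ p₁ 0 / μ * (N + 3) * (N + 1) := by nlinarith
      have h7 := le_of_mul_le_mul_right h6 (by linarith)
      rw [← h5]
      nlinarith
    have hA : 1 / ((N : ℝ) + 3) ^ 2 * (μ + (N + 1) / 2) ≤ 1 / (N + 3) := by
      rw [div_mul_eq_mul_div, div_le_div_iff₀ (by positivity) (by positivity)]
      nlinarith
    calc 1 / ((N : ℝ) + 3) ^ 2 * (μ + (N + 1) / 2) * (2 * ((0 : ℕ) : ℝ) + 2 - μ) * -p 0
        = 1 / ((N : ℝ) + 3) ^ 2 * (μ + (N + 1) / 2) * ((2 - μ) * -p 0) := by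
          push_cast; ring
      _ ≤ 1 / (N + 3) * ((2 - μ) * -p 0) :=
          mul_le_mul_of_nonneg_right hA (mul_nonneg (by linarith) (by linarith))
      _ ≤ p₁ 0 := by
          rw [div_mul_eq_mul_div, div_le_iff₀ (by positivity)]
          nlinarith
  | succ k ih =>
    intro μ h1 h2 p p₁ h
    push_cast at h1 h2
    have hk : (0 : ℝ) ≤ k := Nat.cast_nonneg k
    have hl := (h.lower (by linarith)).lower (by linarith)
    obtain ⟨i1, i2⟩ := ih (μ - 1 - 1) (by linarith) (by linarith) _ _ hl
    simp at i1 i2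
    have hp : p 0 ≠ 0 := fun hh => by simp [hh] at i1
    refine ⟨hp, ?_⟩
    have a1 : 0 < μ := by linarith
    have a2 : 0 < μ - 1 := by linarith
    have a3 : 0 < μ + N - 1 := by linarith
    have a4 : 0 < μ + N - 2 := by linarith
    set R := -(p₁ 0) / p 0 with hR
    have hp1 : p₁ 0 = -(R * p 0) := by rw [hR]; field_simp
    rw [hp1] at i2
    clear_value R
    have i3 : 1 / ((N : ℝ) + 3) ^ 2 * (μ - 2 + (N + 1) / 2) * (2 * k + 4 - μ)
        ≤ (μ + N - 2) * (μ - 1) / (μ * (μ + N - 1)) * R := by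
      convert i2 using 1
      · rw [one_div]; ring
      · field_simp
        ring
    rw [div_mul_eq_mul_div ((μ + N - 2) * (μ - 1)), le_div_iff₀ (by positivity)] at i3
    push_cast
    have a5 : 0 < (μ + N - 2) * (μ - 1) := by positivity
    refine le_of_mul_le_mul_left (le_trans ?_ i3) a5
    have key : (μ + N - 2) * (μ - 1) * (μ + (N + 1) / 2)
        ≤ (μ - 2 + (N + 1) / 2) * (μ * (μ + N - 1)) := by
      nlinarith [sq_nonneg ((N : ℝ) - 1)]
    have a6 : 0 ≤ 1 / ((N : ℝ) + 3) ^ 2 * (2 * k + 4 - μ) :=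
      mul_nonneg (by positivity) (by linarith)
    have := mul_le_mul_of_nonneg_left key a6
    linarith

/-- **Proposition 2.1(b).** For every `n ≥ 2` there is `c > 0` depending only on `n` such
that for every odd positive `m` and `μ ∈ (m, m+1]`, every Legendre function for `(n, μ)`
satisfies `p(0) ≠ 0` and `-p'(0)/p(0) ≥ c·m·(m+1-μ)`. -/
theorem legendre_lower_bound (n : ℕ) (hn : 2 ≤ n) :
    ∃ c : ℝ, 0 < c ∧ ∀ m : ℕ, Odd m → 0 < m → ∀ μ : ℝ, (m : ℝ) < μ → μ ≤ m + 1 →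
      ∀ p p₁ : ℝ → ℝ, IsLegendre n μ p p₁ →
        p 0 ≠ 0 ∧ c * m * ((m : ℝ) + 1 - μ) ≤ -(p₁ 0) / p 0 := by
  obtain ⟨N, rfl⟩ : ∃ N, n = N + 2 := ⟨n - 2, by omega⟩
  refine ⟨1 / ((N : ℝ) + 3) ^ 2, by positivity, ?_⟩
  rintro m ⟨k, rfl⟩ - μ h1 h2 p p₁ h
  push_cast at h1 h2 ⊢
  obtain ⟨i1, i2⟩ := weak_bound N k μ h1 (by linarith) p p₁ h.weak
  refine ⟨i1, le_trans ?_ i2⟩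
  have hN0 : (0 : ℝ) ≤ N := Nat.cast_nonneg N
  have e : 2 * (k : ℝ) + 1 + 1 - μ = 2 * k + 2 - μ := by ring
  rw [e]
  have : 0 ≤ 2 * (k : ℝ) + 2 - μ := by linarith
  have hc : (0 : ℝ) ≤ 1 / ((N : ℝ) + 3) ^ 2 := by positivity
  exact mul_le_mul_of_nonneg_right (mul_le_mul_of_nonneg_left (by linarith) hc) this
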